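/- Assume X is a metric space with a Borel measure finite on balls, and let U ⊂ X be quasiopen. If u : U → [-∞,∞] is C_p^U-quasicontinuous, then u is C_p-quasicontinuous. -/

import Mathlib

open Set MeasureTheory Metric ENNReal

noncomputable section

/-- A rectifiable curve parameterized by arc length, modeled as a 1-Lipschitz
map on `[0, l]`. -/
structure Curve (X : Type*) [MetricSpace X] where
  l : ℝ
  l_nonneg : 0 ≤ l
  toFun : ℝ → X
  lip : LipschitzOnWith 1 toFun (Set.Icc 0 l)

namespace Curve

variable {X : Type*} [MetricSpace X]

/-- A curve is nonconstant if it attains at least two values. -/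
def Nonconstant (γ : Curve X) : Prop :=
  ∃ s ∈ Set.Icc 0 γ.l, ∃ t ∈ Set.Icc 0 γ.l, γ.toFun s ≠ γ.toFun t

/-- The curve integral `∫_γ ρ ds`. -/
def integral (γ : Curve X) (ρ : X → ℝ≥0∞) : ℝ≥0∞ :=
  ∫⁻ t in Set.Icc 0 γ.l, ρ (γ.toFun t)

/-- The curve lies entirely in a set `U`. -/
def InSet (γ : Curve X) (U : Set X) : Prop :=
  ∀ t ∈ Set.Icc 0 γ.l, γ.toFun t ∈ U

end Curve

variable {X : Type*} [MetricSpace X] [MeasurableSpace X] [BorelSpace X]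

/-- `|a - b|` as an element of `[0,∞]`, with the convention that the result is `∞`
whenever one of the terms is infinite. -/
def erealDiff (a b : EReal) : ℝ≥0∞ :=
  if a = ⊤ ∨ a = ⊥ ∨ b = ⊤ ∨ b = ⊥ then ⊤ else ENNReal.ofReal |a.toReal - b.toReal|

/-- `g` is an upper gradient of `f` relative to the set `U` (taking `U = univ`
gives the usual notion of upper gradient on `X`). -/
def IsUpperGradientOn (f : X → EReal) (g : X → ℝ≥0∞) (U : Set X) : Prop :=
  Measurable g ∧ ∀ γ : Curve X, γ.InSet U → γ.Nonconstant →
    erealDiff (f (γ.toFun 0)) (f (γ.toFun γ.l)) ≤ γ.integral g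

/-- The `p`-th power of the Newtonian norm of `f` on `U` (intrinsic to `U`):
`∫_U |f|^p dμ + inf_g ∫_U g^p dμ`, the infimum over all upper gradients of `f` in `U`. -/
def newtonianNormOn (μ : Measure X) (p : ℝ) (U : Set X) (f : X → EReal) : ℝ≥0∞ :=
  (∫⁻ x in U, (f x).abs ^ p ∂μ) +
    ⨅ (g : X → ℝ≥0∞) (_ : IsUpperGradientOn f g U), ∫⁻ x in U, (g x) ^ p ∂μ

/-- The Sobolev capacity `C_p^U`, intrinsic to the metric measure space `U`. -/
def capacityOn (μ : Measure X) (p : ℝ) (U : Set X) (E : Set X) : ℝ≥0∞ :=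
  ⨅ (f : X → EReal) (_ : AEMeasurable f (μ.restrict U) ∧ ∀ x ∈ E, 1 ≤ f x),
    newtonianNormOn μ p U f

/-- The Sobolev capacity `C_p` with respect to the underlying space `X`. -/
def capacity (μ : Measure X) (p : ℝ) (E : Set X) : ℝ≥0∞ :=
  capacityOn μ p Set.univ E

/-- A set `U` is quasiopen if for every `ε > 0` there is an open set `G` with
`C_p(G) < ε` such that `G ∪ U` is open. -/
def Quasiopen (μ : Measure X) (p : ℝ) (U : Set X) : Prop :=
  ∀ ε : ℝ≥0∞, 0 < ε → ∃ G : Set X, IsOpen G ∧ capacity μ p G < ε ∧ IsOpen (G ∪ U)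

/-- `G` is relatively open in `U`. -/
def RelOpenIn (U G : Set X) : Prop := ∃ V : Set X, IsOpen V ∧ G = V ∩ U

/-- `V` is quasiopen in `U` with respect to a capacity `cap`: for every `ε > 0`
there is a relatively open `G ⊆ U` with `cap G < ε` such that `G ∪ V` is relatively
open in `U`. -/
def QuasiopenInWith (cap : Set X → ℝ≥0∞) (U V : Set X) : Prop :=
  ∀ ε : ℝ≥0∞, 0 < ε → ∃ G : Set X, G ⊆ U ∧ RelOpenIn U G ∧ cap G < ε ∧
    RelOpenIn U (G ∪ V)

/-- `u` is `C_p`-quasicontinuous on `U`: for every `ε > 0` there is an open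
`G ⊆ X` with `C_p(G) < ε` such that `u|_{U ∖ G}` is finite and continuous. -/
def QuasicontOn (μ : Measure X) (p : ℝ) (u : X → EReal) (U : Set X) : Prop :=
  ∀ ε : ℝ≥0∞, 0 < ε → ∃ G : Set X, IsOpen G ∧ capacity μ p G < ε ∧
    ContinuousOn u (U \ G) ∧ ∀ x ∈ U \ G, u x ≠ ⊤ ∧ u x ≠ ⊥

/-- `u` is `C_p^U`-quasicontinuous on `U`: for every `ε > 0` there is a relatively
open `G ⊆ U` with `C_p^U(G) < ε` such that `u|_{U ∖ G}` is finite and continuous. -/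
def QuasicontOnSub (μ : Measure X) (p : ℝ) (u : X → EReal) (U : Set X) : Prop :=
  ∀ ε : ℝ≥0∞, 0 < ε → ∃ G : Set X, G ⊆ U ∧ RelOpenIn U G ∧ capacityOn μ p U G < ε ∧
    ContinuousOn u (U \ G) ∧ ∀ x ∈ U \ G, u x ≠ ⊤ ∧ u x ≠ ⊥

/-- A curve family has zero `p`-modulus: there is `0 ≤ ρ ∈ L^p(X)` with
`∫_γ ρ ds = ∞` for every `γ ∈ Γ`. -/
def ZeroModulus (μ : Measure X) (p : ℝ) (Γ : Set (Curve X)) : Prop :=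
  ∃ ρ : X → ℝ≥0∞, Measurable ρ ∧ (∫⁻ x, ρ x ^ p ∂μ) < ⊤ ∧ ∀ γ ∈ Γ, γ.integral ρ = ⊤

/-- `S` is relatively open in `[0, l]`. -/
def RelOpenInIcc (S : Set ℝ) (l : ℝ) : Prop :=
  ∃ V : Set ℝ, IsOpen V ∧ S = V ∩ Set.Icc 0 l

/-- `U` is `p`-path open: for `p`-a.e. curve `γ`, the preimage `γ⁻¹(U)` is
relatively open in `[0, l_γ]`. -/
def PPathOpen (μ : Measure X) (p : ℝ) (U : Set X) : Prop :=
  ∃ Γ : Set (Curve X), ZeroModulus μ p Γ ∧ ∀ γ : Curve X, γ ∉ Γ →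
    RelOpenInIcc {t ∈ Set.Icc 0 γ.l | γ.toFun t ∈ U} γ.l

/-- `f ∈ N^{1,p}(U)` (intrinsic to `U`). -/
def MemNewtonianOn (μ : Measure X) (p : ℝ) (U : Set X) (f : X → EReal) : Prop :=
  AEMeasurable f (μ.restrict U) ∧ newtonianNormOn μ p U f < ⊤

/-- `f ∈ N^{1,p}(X)`. -/
def MemNewtonian (μ : Measure X) (p : ℝ) (f : X → EReal) : Prop :=
  MemNewtonianOn μ p Set.univ f

set_option linter.unusedSectionVars false

open Filter Topology

/-- Continuity from an integral bound. -/
lemma aux_cont (h : ℝ → ℝ) (G : ℝ → ℝ≥0∞) (l t0 : ℝ) (ht0 : t0 ∈ Icc 0 l)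
    (hG : ∫⁻ t in Icc 0 l, G t ≠ ⊤)
    (hh : ∀ᶠ t in 𝓝[Icc 0 l] t0, ENNReal.ofReal |h t - h t0| ≤ ∫⁻ s in uIcc t t0, G s) :
    ContinuousWithinAt h (Icc 0 l) t0 := by
  have h1 : Tendsto (fun t => ∫⁻ s in uIcc t t0, G s ∂(volume.restrict (Icc 0 l)))
      (𝓝[Icc 0 l] t0) (𝓝 0) := by
    apply tendsto_setLIntegral_zero hG
    have h2 : Tendsto (fun t : ℝ => ENNReal.ofReal |t0 - t|) (𝓝[Icc 0 l] t0) (𝓝 0) := by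
      have : Continuous (fun t : ℝ => ENNReal.ofReal |t0 - t|) :=
        ENNReal.continuous_ofReal.comp (by fun_prop)
      have h3 := this.tendsto t0
      simp only [sub_self, abs_zero, ENNReal.ofReal_zero] at h3
      exact h3.mono_left nhdsWithin_le_nhds
    refine tendsto_of_tendsto_of_tendsto_of_le_of_le tendsto_const_nhds h2
      (fun _ => zero_le) ?_
    intro t
    refine (Measure.restrict_apply_le _ _).trans ?_
    simp [Real.volume_interval]
  have h4 : Tendsto (fun t => ENNReal.ofReal |h t - h t0|) (𝓝[Icc 0 l] t0) (𝓝 0) := by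
    refine tendsto_of_tendsto_of_tendsto_of_le_of_le' tendsto_const_nhds h1
      (Eventually.of_forall fun _ => zero_le) ?_
    filter_upwards [hh, self_mem_nhdsWithin] with t ht htI
    refine ht.trans (le_of_eq ?_)
    rw [Measure.restrict_restrict measurableSet_uIcc,
      inter_eq_left.2 ((convex_Icc (0:ℝ) l).ordConnected.uIcc_subset htI ht0)]
  rw [ContinuousWithinAt, tendsto_iff_dist_tendsto_zero]
  have h5 := (ENNReal.tendsto_toReal (zero_ne_top)).comp h4
  refine h5.congr fun t => ?_
  simp [Real.dist_eq]

/-- One-dimensional lemma: it suffices to check the upper gradient inequality on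
segments of positivity. -/
lemma aux_pos (h : ℝ → ℝ) (G : ℝ → ℝ≥0∞) (l : ℝ) (hl : 0 ≤ l)
    (hc : ContinuousOn h (Icc 0 l)) (h0 : ∀ t, 0 ≤ h t)
    (hh : ∀ a b, 0 ≤ a → a ≤ b → b ≤ l → (∀ t ∈ Icc a b, 0 < h t) →
      ENNReal.ofReal |h a - h b| ≤ ∫⁻ s in Icc a b, G s) :
    ENNReal.ofReal |h 0 - h l| ≤ ∫⁻ s in Icc 0 l, G s := by
  by_cases hpos : ∀ t ∈ Icc 0 l, 0 < h t
  · exact hh 0 l le_rfl hl le_rfl hpos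
  push Not at hpos
  obtain ⟨t1, ht1, ht1'⟩ := hpos
  have hz1 : h t1 = 0 := le_antisymm ht1' (h0 _)
  set Z : Set ℝ := Icc 0 l ∩ h ⁻¹' {0} with hZ
  have hZc : IsCompact Z := isCompact_Icc.of_isClosed_subset
    (hc.preimage_isClosed_of_isClosed isClosed_Icc isClosed_singleton) inter_subset_left
  have hZn : Z.Nonempty := ⟨t1, ht1, hz1⟩
  have key : ∀ s x : ℝ, ENNReal.ofReal |h s - h x| ≤ ∫⁻ r in Icc 0 l, G r →
      ENNReal.ofReal (h x) ≤ ENNReal.ofReal (h s) + ∫⁻ r in Icc 0 l, G r := by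
    intro s x hsx
    calc ENNReal.ofReal (h x) ≤ ENNReal.ofReal (h s + |h s - h x|) := by
          apply ENNReal.ofReal_le_ofReal
          linarith [neg_abs_le (h s - h x)]
      _ = ENNReal.ofReal (h s) + ENNReal.ofReal |h s - h x| :=
          ENNReal.ofReal_add (h0 _) (abs_nonneg _)
      _ ≤ _ := by gcongr
  have lim : ∀ (t x : ℝ) (s : Set ℝ), t ∈ Z → s ⊆ Icc 0 l → (𝓝[s] t).NeBot →
      (∀ᶠ r in 𝓝[s] t, ENNReal.ofReal |h r - h x| ≤ ∫⁻ r in Icc 0 l, G r) →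
      ENNReal.ofReal (h x) ≤ ∫⁻ r in Icc 0 l, G r := by
    intro t x s ht hs hne hev
    have h1 : Tendsto h (𝓝[s] t) (𝓝 0) := by
      have := (hc t ht.1).mono hs
      rw [ContinuousWithinAt, show h t = 0 from ht.2] at this
      exact this
    have h2 : Tendsto (fun r => ENNReal.ofReal (h r) + ∫⁻ r in Icc 0 l, G r) (𝓝[s] t)
        (𝓝 (0 + ∫⁻ r in Icc 0 l, G r)) := by
      have := ENNReal.tendsto_ofReal h1
      rw [ENNReal.ofReal_zero] at this
      exact this.add tendsto_const_nhds
    rw [zero_add] at h2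
    exact ge_of_tendsto h2 (hev.mono fun r hr => key r x hr)
  have c1 : ENNReal.ofReal (h 0) ≤ ∫⁻ r in Icc 0 l, G r := by
    have hm := hZc.sInf_mem hZn
    set t := sInf Z
    rcases hm.1.1.eq_or_lt with h00 | hpos
    · have h3 : h t = 0 := hm.2
      rw [h00, h3]; simp
    · have hsub : Ico 0 t ⊆ Icc 0 l := fun x hx => ⟨hx.1, hx.2.le.trans hm.1.2⟩
      refine lim t 0 (Ico 0 t) hm hsub ?_ ?_
      · rw [← mem_closure_iff_nhdsWithin_neBot, closure_Ico hpos.ne]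
        exact ⟨hpos.le, le_rfl⟩
      · filter_upwards [self_mem_nhdsWithin] with r hr
        have := hh 0 r le_rfl hr.1 (hsub hr).2 (by
          intro q hq
          refine lt_of_le_of_ne (h0 q) fun hq0 => ?_
          have : t ≤ q := csInf_le hZc.bddBelow ⟨⟨hq.1, hq.2.trans (hsub hr).2⟩, hq0.symm⟩
          linarith [hq.2, hr.2])
        rw [abs_sub_comm]
        exact this.trans (lintegral_mono_set (Icc_subset_Icc le_rfl (hsub hr).2))
  have c2 : ENNReal.ofReal (h l) ≤ ∫⁻ r in Icc 0 l, G r := by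
    have hm := hZc.sSup_mem hZn
    set t := sSup Z
    rcases hm.1.2.eq_or_lt with h00 | hpos
    · have h3 : h t = 0 := hm.2
      rw [← h00, h3]; simp
    · have hsub : Ioc t l ⊆ Icc 0 l := fun x hx => ⟨hm.1.1.trans hx.1.le, hx.2⟩
      refine lim t l (Ioc t l) hm hsub ?_ ?_
      · rw [← mem_closure_iff_nhdsWithin_neBot, closure_Ioc hpos.ne]
        exact ⟨le_rfl, hpos.le⟩
      · filter_upwards [self_mem_nhdsWithin] with r hr
        have := hh r l (hsub hr).1 hr.2 le_rfl (by
          intro q hq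
          refine lt_of_le_of_ne (h0 q) fun hq0 => ?_
          have : q ≤ t := le_csSup hZc.bddAbove ⟨⟨(hsub hr).1.trans hq.1, hq.2⟩, hq0.symm⟩
          linarith [hq.1, hr.1])
        exact this.trans (lintegral_mono_set (Icc_subset_Icc (hsub hr).1 le_rfl))
  have : |h 0 - h l| ≤ max (h 0) (h l) := by
    rw [abs_le]
    constructor
    · linarith [le_max_right (h 0) (h l), h0 0]
    · linarith [le_max_left (h 0) (h l), h0 l]
  refine (ENNReal.ofReal_le_ofReal this).trans ?_
  rcases max_choice (h 0) (h l) with h' | h' <;> rw [h'] <;> assumption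

/-- Real-valued upper gradient inequality. -/
def RUG (v : X → ℝ) (g : X → ℝ≥0∞) (U : Set X) : Prop :=
  ∀ γ : Curve X, γ.InSet U → ENNReal.ofReal |v (γ.toFun 0) - v (γ.toFun γ.l)| ≤ γ.integral g

lemma RUG.sub {v : X → ℝ} {g : X → ℝ≥0∞} {U : Set X} (h : RUG v g U) (γ : Curve X)
    (a b : ℝ) (ha : 0 ≤ a) (hab : a ≤ b) (hb : b ≤ γ.l) (hU : ∀ t ∈ Icc a b, γ.toFun t ∈ U) :
    ENNReal.ofReal |v (γ.toFun a) - v (γ.toFun b)| ≤ ∫⁻ t in Icc a b, g (γ.toFun t) := by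
  have hm : ∀ t ∈ Icc 0 (b - a), a + t ∈ Icc a b := fun t ht =>
    ⟨by linarith [ht.1], by linarith [ht.2]⟩
  let γ' : Curve X := ⟨b - a, by linarith, fun t => γ.toFun (a + t), by
    have h1 : LipschitzOnWith 1 (fun t : ℝ => a + t) (Icc 0 (b - a)) :=
      (LipschitzWith.of_dist_le_mul (by intro x y; simp)).lipschitzOnWith
    have := γ.lip.comp h1 (fun t ht => ⟨ha.trans (hm t ht).1, (hm t ht).2.trans hb⟩)
    rw [mul_one] at this
    exact this⟩
  have h1 := h γ' (fun t ht => hU _ (hm t ht))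
  have h2 : γ'.integral g = ∫⁻ t in Icc a b, g (γ.toFun t) := by
    have := (measurePreserving_add_left (volume : Measure ℝ) a).setLIntegral_comp_preimage_emb
      (measurableEmbedding_addLeft a) (fun t => g (γ.toFun t)) (Icc a b)
    rw [← this]
    simp [Curve.integral, γ']
  rw [h2] at h1
  simpa [γ'] using h1

lemma ofReal_abs_min_sub_min_le {a b c d : ℝ} {M : ℝ≥0∞} (h1 : ENNReal.ofReal |a - c| ≤ M)
    (h2 : ENNReal.ofReal |b - d| ≤ M) : ENNReal.ofReal |min a b - min c d| ≤ M := by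
  refine (ENNReal.ofReal_le_ofReal (abs_min_sub_min_le_max a b c d)).trans ?_
  rcases max_choice |a - c| |b - d| with h | h <;> rw [h] <;> assumption

lemma RUG.continuousOn {w : X → ℝ} {g : X → ℝ≥0∞} (h : RUG w g univ) (γ : Curve X)
    (hg : ∫⁻ t in Icc 0 γ.l, g (γ.toFun t) ≠ ⊤) :
    ContinuousOn (fun t => w (γ.toFun t)) (Icc 0 γ.l) := by
  intro t0 ht0
  apply aux_cont _ _ _ _ ht0 hg
  filter_upwards [self_mem_nhdsWithin] with t ht
  rcases le_total t t0 with h' | h'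
  · rw [uIcc_of_le h']
    exact h.sub γ _ _ ht.1 h' ht0.2 (fun _ _ => mem_univ _)
  · rw [uIcc_of_ge h', abs_sub_comm]
    exact h.sub γ _ _ ht0.1 h' ht.2 (fun _ _ => mem_univ _)

lemma main_curve (U U' Ω : Set X) (hUU' : U ⊆ U') (hΩ : IsOpen Ω)
    (w v η : X → ℝ) (gw g v' : X → ℝ≥0∞) (L : NNReal)
    (hw1 : ∀ x, w x ≤ 1) (hw : RUG w gw univ)
    (hv : RUG v g U) (hv' : ∀ x ∈ U, ENNReal.ofReal (v x) ≤ v' x)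
    (hη : LipschitzWith L η) (hη0 : ∀ x, 0 ≤ η x) (hηΩ : ∀ x, x ∉ Ω → η x = 0)
    (hsub : ∀ x, w x < 1 → x ∈ Ω → x ∈ U) :
    RUG (fun x => min (max (2 * v x - 1) 0) (min (η x) (1 - w x)))
      (fun x => U'.indicator (fun x => 2 * g x + 2 * (L * v' x)) x + gw x) univ := by
  intro γ _
  set G : X → ℝ≥0∞ := fun x => U'.indicator (fun x => 2 * g x + 2 * (L * v' x)) x + gw x with hGdef
  set f : X → ℝ := fun x => min (max (2 * v x - 1) 0) (min (η x) (1 - w x)) with hf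
  by_cases hG : ∫⁻ t in Icc 0 γ.l, G (γ.toFun t) = ⊤
  · rw [Curve.integral, hG]; exact le_top
  have hgw : ∫⁻ t in Icc 0 γ.l, gw (γ.toFun t) ≠ ⊤ :=
    ne_top_of_le_ne_top hG (lintegral_mono fun t => le_add_self)
  have hwc := hw.continuousOn γ hgw
  have hγc := γ.lip.continuousOn
  have hηc : ContinuousOn (fun t => η (γ.toFun t)) (Icc 0 γ.l) :=
    hη.continuous.comp_continuousOn hγc
  have hf0 : ∀ x, 0 ≤ f x := fun x =>
    le_min (le_max_right _ _) (le_min (hη0 x) (by linarith [hw1 x]))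
  have hGU : ∀ x ∈ U, 2 * g x ≤ G x := fun x hx => by
    simp only [hGdef, indicator_of_mem (hUU' hx)]
    rw [add_assoc]; exact le_self_add
  have hGU2 : ∀ x ∈ U, 2 * (L * v' x) ≤ G x := fun x hx => by
    simp only [hGdef, indicator_of_mem (hUU' hx)]
    rw [add_comm (2 * g x), add_assoc]; exact le_self_add
  have hvseg : ∀ a b, 0 ≤ a → a ≤ b → b ≤ γ.l → (∀ t ∈ Icc a b, γ.toFun t ∈ U) →
      2 * ENNReal.ofReal |v (γ.toFun a) - v (γ.toFun b)| ≤ ∫⁻ t in Icc a b, G (γ.toFun t) := by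
    intro a b ha hab hb hU
    calc _ ≤ 2 * ∫⁻ t in Icc a b, g (γ.toFun t) := by
          gcongr; exact hv.sub γ a b ha hab hb hU
      _ ≤ ∫⁻ t in Icc a b, 2 * g (γ.toFun t) := lintegral_const_mul_le _ _
      _ ≤ _ := setLIntegral_mono' measurableSet_Icc fun t ht => hGU _ (hU t ht)
  have hcont : ContinuousOn (fun t => f (γ.toFun t)) (Icc 0 γ.l) := by
    intro t0 ht0
    by_cases hcase : w (γ.toFun t0) < 1 ∧ γ.toFun t0 ∈ Ω
    · have hev : ∀ᶠ t in 𝓝[Icc 0 γ.l] t0, γ.toFun t ∈ U := by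
        filter_upwards [(hwc t0 ht0).eventually (isOpen_Iio.mem_nhds hcase.1),
          (hγc t0 ht0).eventually (hΩ.mem_nhds hcase.2)] with t h1 h2
        exact hsub _ h1 h2
      obtain ⟨δ, hδ, hball⟩ := Metric.mem_nhdsWithin_iff.1 hev
      have hvc : ContinuousWithinAt (fun t => v (γ.toFun t)) (Icc 0 γ.l) t0 := by
        apply aux_cont _ (fun t => G (γ.toFun t)) _ _ ht0 hG
        have hb : ball t0 δ ∈ 𝓝[Icc 0 γ.l] t0 :=
          nhdsWithin_le_nhds (Metric.ball_mem_nhds _ hδ)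
        filter_upwards [self_mem_nhdsWithin, hb] with t ht htb
        have hseg : ∀ s ∈ uIcc t t0, γ.toFun s ∈ U := by
          intro s hs
          apply hball
          refine ⟨?_, (convex_Icc (0:ℝ) γ.l).ordConnected.uIcc_subset ht ht0 hs⟩
          exact (convex_ball t0 δ).ordConnected.uIcc_subset htb (mem_ball_self hδ) hs
        have h2 : ∀ y : ℝ≥0∞, y ≤ 2 * y := fun y => by rw [two_mul]; exact le_self_add
        rcases le_total t t0 with h' | h'
        · rw [uIcc_of_le h'] at hseg ⊢
          exact (h2 _).trans (hvseg _ _ ht.1 h' ht0.2 hseg)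
        · rw [uIcc_of_ge h'] at hseg ⊢
          rw [abs_sub_comm]
          exact (h2 _).trans (hvseg _ _ ht0.1 h' ht.2 hseg)
      have hA : ContinuousWithinAt (fun t => max (2 * v (γ.toFun t) - 1) 0) (Icc 0 γ.l) t0 :=
        ((continuousWithinAt_const.mul hvc).sub continuousWithinAt_const).max
          continuousWithinAt_const
      exact hA.min ((hηc t0 ht0).min (continuousWithinAt_const.sub (hwc t0 ht0)))
    · have hm0 : min (η (γ.toFun t0)) (1 - w (γ.toFun t0)) = 0 := by
        have h1 := hw1 (γ.toFun t0)
        by_cases hO : γ.toFun t0 ∈ Ω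
        · have : w (γ.toFun t0) = 1 := le_antisymm h1 (not_lt.1 fun h => hcase ⟨h, hO⟩)
          rw [this, sub_self]; exact min_eq_right (hη0 _)
        · rw [hηΩ _ hO]; exact min_eq_left (by linarith)
      have hft : f (γ.toFun t0) = 0 := by
        refine le_antisymm ?_ (hf0 _)
        rw [← hm0]; exact min_le_right _ _
      have hmc : Tendsto (fun t => min (η (γ.toFun t)) (1 - w (γ.toFun t))) (𝓝[Icc 0 γ.l] t0)
          (𝓝 0) := by
        have := (hηc t0 ht0).min (continuousWithinAt_const (b := (1:ℝ)).sub (hwc t0 ht0))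
        have h2 : Tendsto (fun t => min (η (γ.toFun t)) (1 - w (γ.toFun t))) (𝓝[Icc 0 γ.l] t0)
          (𝓝 (min (η (γ.toFun t0)) (1 - w (γ.toFun t0)))) := this
        rw [hm0] at h2
        exact h2
      rw [ContinuousWithinAt, hft]
      exact squeeze_zero (fun t => hf0 _) (fun t => min_le_right _ _) hmc
  refine aux_pos (fun t => f (γ.toFun t)) (fun t => G (γ.toFun t)) γ.l γ.l_nonneg hcont
    (fun t => hf0 _) ?_
  intro a b ha hab hb hpos
  have hp : ∀ t ∈ Icc a b, γ.toFun t ∈ U ∧ 1 / 2 < v (γ.toFun t) := by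
    intro t ht
    have h1 := hpos t ht
    simp only [hf, lt_min_iff, lt_max_iff, lt_irrefl, or_false] at h1
    refine ⟨hsub _ (by linarith [h1.2.2]) ?_, by linarith [h1.1]⟩
    by_contra hO
    rw [hηΩ _ hO] at h1
    exact lt_irrefl _ h1.2.1
  apply ofReal_abs_min_sub_min_le
  · refine le_trans ?_ (hvseg a b ha hab hb fun t ht => (hp t ht).1)
    rw [← ENNReal.ofReal_ofNat 2, ← ENNReal.ofReal_mul (by norm_num)]
    apply ENNReal.ofReal_le_ofReal
    refine (abs_max_sub_max_le_max _ _ _ _).trans ?_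
    rw [sub_self, abs_zero, max_eq_left (abs_nonneg _)]
    rw [show 2 * v (γ.toFun a) - 1 - (2 * v (γ.toFun b) - 1)
      = 2 * (v (γ.toFun a) - v (γ.toFun b)) by ring, abs_mul, abs_two]
  apply ofReal_abs_min_sub_min_le
  · have h1 : |η (γ.toFun a) - η (γ.toFun b)| ≤ L * (b - a) := by
      have h2 := hη.dist_le_mul (γ.toFun a) (γ.toFun b)
      have h3 := γ.lip.dist_le_mul a ⟨ha, hab.trans hb⟩ b ⟨ha.trans hab, hb⟩
      rw [Real.dist_eq] at h2 h3
      rw [abs_sub_comm a b, abs_of_nonneg (sub_nonneg.2 hab)] at h3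
      refine h2.trans ?_
      gcongr
      simpa using h3
    calc ENNReal.ofReal |η (γ.toFun a) - η (γ.toFun b)| ≤ ENNReal.ofReal (L * (b - a)) :=
          ENNReal.ofReal_le_ofReal h1
      _ = ∫⁻ t in Icc a b, (L : ℝ≥0∞) := by
          rw [setLIntegral_const, Real.volume_Icc, ENNReal.ofReal_mul L.coe_nonneg,
            ENNReal.ofReal_coe_nnreal]
      _ ≤ ∫⁻ t in Icc a b, G (γ.toFun t) := by
          refine setLIntegral_mono' measurableSet_Icc fun t ht => ?_
          refine le_trans ?_ (hGU2 _ (hp t ht).1)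
          have h3 : (2:ℝ≥0∞)⁻¹ ≤ v' (γ.toFun t) := by
            refine le_trans ?_ (hv' _ (hp t ht).1)
            rw [← ENNReal.ofReal_ofNat 2, ← ENNReal.ofReal_inv_of_pos (by norm_num)]
            apply ENNReal.ofReal_le_ofReal
            linarith [(hp t ht).2]
          calc (L : ℝ≥0∞) = 2 * (L * 2⁻¹) := by
                rw [mul_comm (L : ℝ≥0∞), ← mul_assoc,
                  ENNReal.mul_inv_cancel (by simp) (by simp), one_mul]
            _ ≤ _ := by gcongr
  · rw [show 1 - w (γ.toFun a) - (1 - w (γ.toFun b)) = -(w (γ.toFun a) - w (γ.toFun b)) by ring,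
      abs_neg]
    refine (hw.sub γ a b ha hab hb fun _ _ => mem_univ _).trans ?_
    exact lintegral_mono fun t => le_add_self

/-- Extracting a normalized test function from the capacity. -/
lemma cap_rep (μ : Measure X) (p : ℝ) (hp : 1 ≤ p) (U E : Set X) (ε : ℝ≥0∞)
    (h : capacityOn μ p U E < ε) :
    ∃ (v : X → ℝ) (g : X → ℝ≥0∞), (∀ x, 0 ≤ v x) ∧ (∀ x, v x ≤ 1) ∧ (∀ x ∈ E, v x = 1) ∧
      AEMeasurable v (μ.restrict U) ∧ Measurable g ∧ RUG v g U ∧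
      (∫⁻ x in U, ENNReal.ofReal (v x) ^ p ∂μ) + (∫⁻ x in U, g x ^ p ∂μ) < ε := by
  simp only [capacityOn, iInf_lt_iff] at h
  obtain ⟨f, ⟨hfm, hfE⟩, hN⟩ := h
  rw [newtonianNormOn, ← lt_tsub_iff_left] at hN
  simp only [iInf_lt_iff] at hN
  obtain ⟨g, ⟨hgm, hg⟩, hN⟩ := hN
  rw [lt_tsub_iff_left] at hN
  have hr : ∀ r : ℝ, (max 0 (min (r : EReal) 1)).toReal = max 0 (min r 1) := by
    intro r
    rw [← EReal.coe_one, ← EReal.coe_zero, ← EReal.coe_strictMono.monotone.map_min,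
      ← EReal.coe_strictMono.monotone.map_max, EReal.toReal_coe]
  have ht : (max 0 (min (⊤ : EReal) 1)).toReal = 1 := by simp
  have hb : (max 0 (min (⊥ : EReal) 1)).toReal = 0 := by simp
  refine ⟨fun x => (max 0 (min (f x) 1)).toReal, g, ?_, ?_, ?_, ?_, hgm, ?_, ?_⟩
  · intro x
    exact EReal.toReal_nonneg (le_max_left _ _)
  · intro x
    dsimp only
    induction f x with
    | bot => rw [hb]; norm_num
    | top => rw [ht]
    | coe r => rw [hr]; exact max_le zero_le_one (min_le_right _ _)
  · intro x hx
    dsimp only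
    rw [min_eq_right (hfE x hx), max_eq_right zero_le_one]; simp
  · exact measurable_ereal_toReal.comp_aemeasurable
      (aemeasurable_const.max (hfm.min aemeasurable_const))
  · intro γ hγ
    by_cases hnc : γ.Nonconstant
    · refine le_trans ?_ (hg γ hγ hnc)
      dsimp only
      generalize f (γ.toFun 0) = a
      generalize f (γ.toFun γ.l) = b
      unfold erealDiff
      split_ifs with hab
      · exact le_top
      · push Not at hab
        obtain ⟨h1, h2, h3, h4⟩ := hab
        lift a to ℝ using ⟨h1, h2⟩
        lift b to ℝ using ⟨h3, h4⟩
        rw [hr, hr, EReal.toReal_coe, EReal.toReal_coe]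
        apply ENNReal.ofReal_le_ofReal
        refine (abs_max_sub_max_le_max _ _ _ _).trans (max_le (by simp) ?_)
        refine (abs_min_sub_min_le_max _ _ _ _).trans (max_le le_rfl (by simp))
    · have : γ.toFun 0 = γ.toFun γ.l := by
        by_contra hne
        exact hnc ⟨0, ⟨le_rfl, γ.l_nonneg⟩, γ.l, ⟨γ.l_nonneg, le_rfl⟩, hne⟩
      rw [this]; simp
  · refine lt_of_le_of_lt ?_ hN
    gcongr with x
    dsimp only
    induction f x with
    | bot => rw [hb]; simp
    | top => simp
    | coe r =>
      rw [hr, EReal.abs_def]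
      apply ENNReal.ofReal_le_ofReal
      exact max_le (abs_nonneg _) ((min_le_left _ _).trans (le_abs_self _))

lemma measure_le_cap (μ : Measure X) (p : ℝ) (hp : 1 ≤ p) (G : Set X) (hG : IsOpen G) (ε : ℝ≥0∞)
    (h : capacity μ p G < ε) : μ G ≤ ε := by
  obtain ⟨v, g, h0, h1, hE, -, -, -, hN⟩ := cap_rep μ p hp univ G ε h
  calc μ G = ∫⁻ x in G, 1 ∂μ := by simp
    _ ≤ ∫⁻ x in G, ENNReal.ofReal (v x) ^ p ∂μ :=
        setLIntegral_mono' hG.measurableSet fun x hx => by rw [hE x hx]; simp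
    _ ≤ ∫⁻ x in univ, ENNReal.ofReal (v x) ^ p ∂μ := lintegral_mono_set (subset_univ _)
    _ ≤ ε := le_self_add.trans hN.le

lemma quasiopen_borel (μ : Measure X) (p : ℝ) (hp : 1 ≤ p) (U : Set X) (hU : Quasiopen μ p U) :
    ∃ U' : Set X, MeasurableSet U' ∧ U ⊆ U' ∧ U =ᵐ[μ] U' := by
  have : ∀ n : ℕ, ∃ G : Set X, IsOpen G ∧ capacity μ p G < ((n : ℝ≥0∞) + 1)⁻¹ ∧ IsOpen (G ∪ U) :=
    fun n => hU _ (by simp)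
  choose G hG hc hGU using this
  refine ⟨⋂ n, (G n ∪ U), MeasurableSet.iInter fun n => (hGU n).measurableSet,
    subset_iInter fun n => subset_union_right, ?_⟩
  have h0 : μ (⋂ n, G n) = 0 := by
    refine le_antisymm (ge_of_tendsto' (f := fun n : ℕ => ((n : ℝ≥0∞) + 1)⁻¹) (x := atTop) ?_
      fun n => (measure_mono (iInter_subset _ n)).trans (measure_le_cap μ p hp _ (hG n) _ (hc n)))
      zero_le
    have := (tendsto_add_atTop_iff_nat 1).2 ENNReal.tendsto_inv_nat_nhds_zero
    simpa using this
  refine (LE.le.eventuallyLE (subset_iInter fun n => subset_union_right)).antisymm ?_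
  rw [ae_le_set]
  refine measure_mono_null ?_ h0
  rintro x ⟨hx, hxU⟩
  exact mem_iInter.2 fun n => (mem_iInter.1 hx n).resolve_right hxU

/-- Measurable pointwise majorant which is a.e. equal. -/
lemma exists_majorant (ν : Measure X) (v : X → ℝ≥0∞) (hv : AEMeasurable v ν) :
    ∃ v' : X → ℝ≥0∞, Measurable v' ∧ (∀ x, v x ≤ v' x) ∧ v' =ᵐ[ν] v := by
  classical
  set N := toMeasurable ν {x | v x ≠ hv.mk v x} with hN
  have hN0 : ν N = 0 := by rw [hN, measure_toMeasurable]; exact hv.ae_eq_mk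
  refine ⟨N.piecewise (fun _ => ⊤) (hv.mk v),
    Measurable.piecewise (measurableSet_toMeasurable _ _) measurable_const hv.measurable_mk, ?_, ?_⟩
  · intro x
    by_cases hx : x ∈ N
    · rw [piecewise_eq_of_mem _ _ _ hx]; exact le_top
    · rw [piecewise_eq_of_notMem _ _ _ hx]
      have : ¬ (v x ≠ hv.mk v x) := fun h => hx (subset_toMeasurable _ _ h)
      exact (not_not.1 this).le
  · have h1 : ∀ᵐ x ∂ν, x ∉ N := measure_eq_zero_iff_ae_notMem.1 hN0
    filter_upwards [h1, hv.ae_eq_mk] with x hx hx2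
    rw [piecewise_eq_of_notMem _ _ _ hx, hx2]

lemma exists_cutoff (Ω : Set X) (hΩ : IsOpen Ω) :
    ∃ (η : ℕ → X → ℝ) (W : ℕ → Set X), (∀ n : ℕ, LipschitzWith ((n : NNReal) + 1) (η n)) ∧
      (∀ n x, 0 ≤ η n x) ∧ (∀ n x, x ∉ Ω → η n x = 0) ∧ (∀ n, IsOpen (W n)) ∧
      (∀ n, ∀ x ∈ W n, 1 ≤ η n x) ∧ (∀ n, W n ⊆ Ω) ∧ ∀ x ∈ Ω, ∃ n, x ∈ W n := by
  by_cases hne : (Ωᶜ).Nonempty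
  · have hl : ∀ n : ℕ, LipschitzWith ((n : NNReal) + 1)
        (fun x => ((n : ℝ) + 1) * infDist x Ωᶜ) := by
      intro n
      apply LipschitzWith.of_dist_le_mul
      intro x y
      rw [Real.dist_eq, ← mul_sub, abs_mul, abs_of_nonneg (by positivity : (0:ℝ) ≤ n + 1)]
      have := (lipschitz_infDist_pt (Ωᶜ)).dist_le_mul x y
      rw [Real.dist_eq] at this
      push_cast at this ⊢
      rw [one_mul] at this
      gcongr
    refine ⟨fun n x => ((n : ℝ) + 1) * infDist x Ωᶜ,
      fun n => {x | 1 < ((n : ℝ) + 1) * infDist x Ωᶜ}, hl, ?_, ?_, ?_, ?_, ?_, ?_⟩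
    · intro n x; exact mul_nonneg (by positivity) infDist_nonneg
    · intro n x hx
      simp [infDist_zero_of_mem (show x ∈ Ωᶜ from hx)]
    · intro n
      exact isOpen_lt continuous_const (hl n).continuous
    · intro n x hx; exact le_of_lt hx
    · intro n x hx
      by_contra hO
      simp only [mem_ofPred_eq, infDist_zero_of_mem (show x ∈ Ωᶜ from hO), mul_zero] at hx
      linarith
    · intro x hx
      have hd : 0 < infDist x Ωᶜ :=
        (hΩ.isClosed_compl.notMem_iff_infDist_pos hne).1 (by simpa using hx)
      obtain ⟨n, hn⟩ := exists_nat_gt (1 / infDist x Ωᶜ)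
      refine ⟨n, ?_⟩
      rw [div_lt_iff₀ hd] at hn
      simp only [mem_ofPred_eq]
      nlinarith
  · have hu : Ω = univ := by
      rw [not_nonempty_iff_eq_empty, compl_empty_iff] at hne; exact hne
    refine ⟨fun _ _ => 1, fun _ => univ, fun n => (LipschitzWith.const 1).weaken zero_le,
      ?_, ?_, ?_, ?_, ?_, ?_⟩ <;> simp [hu]

lemma two_rpow_add (p : ℝ) (hp : 1 ≤ p) (a b : ℝ≥0∞) :
    (a + b) ^ p ≤ 2 ^ p * (a ^ p + b ^ p) := by
  refine (ENNReal.rpow_add_le_mul_rpow_add_rpow a b hp).trans ?_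
  gcongr
  · norm_num
  · linarith

lemma lint_bound (μ : Measure X) (p : ℝ) (hp : 1 ≤ p) (a : X → ℝ≥0∞) (B : ℕ → X → ℝ≥0∞)
    (ha : AEMeasurable a μ) (hB : ∀ k, Measurable (B k)) :
    ∫⁻ x, (a x + ⨆ k, B k x) ^ p ∂μ ≤ 2 ^ p * (∫⁻ x, a x ^ p ∂μ + ∑' k, ∫⁻ x, B k x ^ p ∂μ) := by
  have hp0 : 0 < p := by linarith
  have h2 : (2 : ℝ≥0∞) ^ p ≠ ⊤ := ENNReal.rpow_ne_top_of_nonneg hp0.le (by simp)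
  calc _ ≤ ∫⁻ x, 2 ^ p * (a x ^ p + ∑' k, B k x ^ p) ∂μ := by
        refine lintegral_mono fun x => (two_rpow_add p hp _ _).trans ?_
        gcongr
        rw [← ENNReal.le_rpow_inv_iff hp0]
        refine iSup_le fun k => ?_
        rw [ENNReal.le_rpow_inv_iff hp0]
        exact ENNReal.le_tsum k
    _ = 2 ^ p * ∫⁻ x, (a x ^ p + ∑' k, B k x ^ p) ∂μ := lintegral_const_mul' _ _ h2
    _ = _ := by
        rw [lintegral_add_left' (ha.pow_const p),
          lintegral_tsum fun k => ((hB k).pow_const p).aemeasurable]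

lemma ofReal_abs_iSup_le (f h : ℕ → ℝ) (hf : BddAbove (range f)) (hh : BddAbove (range h))
    (M : ℝ≥0∞) (hM : ∀ k, ENNReal.ofReal |f k - h k| ≤ M) :
    ENNReal.ofReal |(⨆ k, f k) - ⨆ k, h k| ≤ M := by
  by_cases hT : M = ⊤
  · rw [hT]; exact le_top
  have h1 : ∀ k, |f k - h k| ≤ M.toReal := fun k => (ENNReal.ofReal_le_iff_le_toReal hT).1 (hM k)
  rw [ENNReal.ofReal_le_iff_le_toReal hT, abs_le]
  constructor
  · have : ⨆ k, h k ≤ (⨆ k, f k) + M.toReal := ciSup_le fun k => by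
      linarith [le_ciSup hf k, (abs_le.1 (h1 k)).1]
    linarith
  · have : ⨆ k, f k ≤ (⨆ k, h k) + M.toReal := ciSup_le fun k => by
      linarith [le_ciSup hh k, (abs_le.1 (h1 k)).2]
    linarith

/-- The main capacity estimate. -/
lemma cap_estimate (μ : Measure X) (p : ℝ) (hp : 1 ≤ p) (U U' Ω G' : Set X)
    (hU'm : MeasurableSet U') (hUU' : U ⊆ U') (hae : U =ᵐ[μ] U')
    (hΩ : IsOpen Ω) (hΩU : Ω = G' ∪ U)
    (η : ℕ → X → ℝ) (W : ℕ → Set X)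
    (hη : ∀ n : ℕ, LipschitzWith ((n : NNReal) + 1) (η n))
    (hη0 : ∀ n x, 0 ≤ η n x) (hηΩ : ∀ n x, x ∉ Ω → η n x = 0)
    (hW1 : ∀ n, ∀ x ∈ W n, 1 ≤ η n x)
    (H : ℕ → Set X) (e : ℕ → ℝ≥0∞) (d : ℝ≥0∞)
    (hG' : capacity μ p G' < d) (hH : ∀ n, capacityOn μ p U (H n) < e n) :
    capacity μ p (G' ∪ ⋃ n, (H n ∩ W n)) ≤
      (2 * 2 ^ p * 2 ^ p * 2 ^ p) * (d + ∑' n : ℕ, ((n : ℝ≥0∞) + 1) ^ p * e n) := by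
  have hp0 : 0 < p := by linarith
  have h2 : (1 : ℝ≥0∞) ≤ 2 ^ p := ENNReal.one_le_rpow (by norm_num) hp0
  obtain ⟨w, gw, hw0, hw1, hwG, hwm, hgwm, hw, hwN⟩ := cap_rep μ p hp univ G' d hG'
  rw [Measure.restrict_univ] at hwm hwN
  choose v g hv0 hv1 hvH hvm hgm hv hvN using fun n => cap_rep μ p hp U (H n) (e n) (hH n)
  choose v' hv'm hvv' hv'ae using fun n => exists_majorant (μ.restrict U)
    (fun x => ENNReal.ofReal (v n x)) (hvm n).ennreal_ofReal
  have hUn : NullMeasurableSet U μ := hU'm.nullMeasurableSet.congr hae.symm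
  set f : ℕ → X → ℝ := fun n x => min (max (2 * v n x - 1) 0) (min (η n x) (1 - w x)) with hf
  set B : ℕ → X → ℝ≥0∞ := fun n => U'.indicator
    (fun x => 2 * g n x + 2 * (((n : NNReal) + 1 : NNReal) * v' n x)) with hBdef
  have hsub : ∀ x, w x < 1 → x ∈ Ω → x ∈ U := by
    intro x hx hxO
    rw [hΩU] at hxO
    exact hxO.resolve_left fun h => hx.ne (hwG x h)
  have hfug : ∀ n, RUG (f n) (fun x => B n x + gw x) univ := fun n =>
    main_curve U U' Ω hUU' hΩ w (v n) (η n) gw (g n) (v' n) _ hw1 hw (hv n)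
      (fun x _ => hvv' n x) (hη n) (hη0 n) (hηΩ n) hsub
  have hBm : ∀ n, Measurable (B n) := fun n =>
    (((hgm n).const_mul 2).add (((hv'm n).const_mul _).const_mul 2)).indicator hU'm
  have hf0 : ∀ n x, 0 ≤ f n x := fun n x =>
    le_min (le_max_right _ _) (le_min (hη0 n x) (by linarith [hw1 x]))
  have hfw : ∀ n x, f n x ≤ 1 - w x := fun n x =>
    (min_le_right _ _).trans (min_le_right _ _)
  have hfU : ∀ n x, x ∉ U → f n x = 0 := by
    intro n x hx
    refine le_antisymm ?_ (hf0 n x)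
    by_cases hO : x ∈ Ω
    · have : ¬ w x < 1 := fun h => hx (hsub x h hO)
      linarith [hfw n x]
    · rw [← hηΩ n x hO]
      exact (min_le_right _ _).trans (min_le_left _ _)
  have hbdd : ∀ x, BddAbove (range fun n => f n x) := fun x =>
    ⟨1 - w x, by rintro _ ⟨n, rfl⟩; exact hfw n x⟩
  have hfB : ∀ n x, ENNReal.ofReal (f n x) ≤ B n x := by
    intro n x
    by_cases hx : x ∈ U
    · have h1 : f n x ≤ v n x :=
        (min_le_left _ _).trans (max_le (by linarith [hv1 n x]) (hv0 n x))
      simp only [hBdef, indicator_of_mem (hUU' hx)]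
      calc ENNReal.ofReal (f n x) ≤ v' n x := (ENNReal.ofReal_le_ofReal h1).trans (hvv' n x)
        _ = 1 * (1 * v' n x) := by simp
        _ ≤ 2 * (((n : NNReal) + 1 : NNReal) * v' n x) := by
            gcongr
            · norm_num
            · norm_cast; simp
        _ ≤ _ := le_add_self
    · rw [hfU n x hx]; simp
  have hfm : ∀ n, AEMeasurable (f n) μ := by
    intro n
    have h1 : f n = U.indicator (f n) := by
      ext x
      by_cases hx : x ∈ U
      · rw [indicator_of_mem hx]
      · rw [indicator_of_notMem hx, hfU n x hx]
    rw [h1, aemeasurable_indicator_iff₀ hUn]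
    refine AEMeasurable.min (((hvm n).const_mul 2).sub_const 1 |>.max aemeasurable_const) ?_
    exact ((hη n).continuous.measurable.aemeasurable).min
      (aemeasurable_const.sub hwm.restrict)
  set F : X → ℝ := fun x => w x + ⨆ n, f n x with hF
  have hFm : AEMeasurable F μ := hwm.add (AEMeasurable.iSup hfm)
  set Gr : X → ℝ≥0∞ := fun x => 2 * gw x + ⨆ n, B n x with hGr
  have hGrm : Measurable Gr := (hgwm.const_mul 2).add (Measurable.iSup hBm)
  have hsup0 : ∀ x, 0 ≤ ⨆ n, f n x := fun x => Real.iSup_nonneg fun n => hf0 n x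
  have hF0 : ∀ x, 0 ≤ F x := fun x => add_nonneg (hw0 x) (hsup0 x)
  have hFB : ∀ x, ENNReal.ofReal (F x) ≤ ENNReal.ofReal (w x) + ⨆ n, B n x := by
    intro x
    refine ENNReal.ofReal_add_le.trans ?_
    gcongr
    by_cases hT : ⨆ n, B n x = ⊤
    · rw [hT]; exact le_top
    rw [ENNReal.ofReal_le_iff_le_toReal hT]
    refine ciSup_le fun n => ?_
    rw [← ENNReal.ofReal_le_iff_le_toReal hT]
    exact (hfB n x).trans (le_iSup (fun n => B n x) n)
  have hug : IsUpperGradientOn (fun x => (F x : EReal)) Gr univ := by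
    refine ⟨hGrm, fun γ hγ _ => ?_⟩
    simp only [erealDiff, EReal.coe_ne_top, EReal.coe_ne_bot, or_self, if_false, EReal.toReal_coe]
    have h1 := hw γ hγ
    have h3 : ENNReal.ofReal |(⨆ n, f n (γ.toFun 0)) - ⨆ n, f n (γ.toFun γ.l)| ≤
        γ.integral (fun x => gw x + ⨆ n, B n x) := by
      refine ofReal_abs_iSup_le _ _ (hbdd _) (hbdd _) _ fun n => (hfug n γ hγ).trans ?_
      refine lintegral_mono fun t => ?_
      dsimp only
      rw [add_comm]
      gcongr
      exact le_iSup (fun n => B n (γ.toFun t)) n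
    calc _ ≤ ENNReal.ofReal (|w (γ.toFun 0) - w (γ.toFun γ.l)| +
          |(⨆ n, f n (γ.toFun 0)) - ⨆ n, f n (γ.toFun γ.l)|) := by
          apply ENNReal.ofReal_le_ofReal
          rw [hF]; dsimp only
          rw [add_sub_add_comm]
          exact abs_add_le _ _
      _ ≤ _ := ENNReal.ofReal_add_le
      _ ≤ γ.integral gw + γ.integral (fun x => gw x + ⨆ n, B n x) := add_le_add h1 h3
      _ ≤ _ := le_lintegral_add _ _
      _ = _ := by
          refine lintegral_congr fun t => ?_
          simp only [hGr, two_mul, add_assoc]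
  have hcap : capacity μ p (G' ∪ ⋃ n, (H n ∩ W n)) ≤
      ∫⁻ x, ENNReal.ofReal (F x) ^ p ∂μ + ∫⁻ x, Gr x ^ p ∂μ := by
    have hadm : AEMeasurable (fun x => (F x : EReal)) (μ.restrict univ) ∧
        ∀ x ∈ G' ∪ ⋃ n, (H n ∩ W n), (1 : EReal) ≤ (F x : EReal) := by
     constructor
     · rw [Measure.restrict_univ]
       exact hFm.coe_real_ereal
     · intro x hx
       rw [← EReal.coe_one, EReal.coe_le_coe_iff]
       rcases hx with hx | hx
       · have := hwG x hx
         have := hsup0 x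
         simp only [hF]; linarith
       · obtain ⟨n, hn1, hn2⟩ := mem_iUnion.1 hx
         have h3 : 1 - w x ≤ f n x := by
           refine le_min ?_ (le_min ?_ le_rfl)
           · rw [hvH n x hn1]
             exact le_max_of_le_left (by linarith [hw0 x])
           · linarith [hW1 n x hn2, hw0 x]
         have := le_ciSup (hbdd x) n
         simp only [hF]; linarith
    refine (iInf₂_le (fun x => (F x : EReal)) hadm).trans ?_
    · rw [newtonianNormOn, Measure.restrict_univ]
      refine add_le_add (le_of_eq ?_) (iInf₂_le Gr hug)
      refine lintegral_congr fun x => ?_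
      rw [EReal.abs_def, abs_of_nonneg (hF0 x)]
  refine hcap.trans ?_
  have hBn : ∀ n : ℕ, ∫⁻ x, B n x ^ p ∂μ ≤ 2 ^ p * 2 ^ p * (((n : ℝ≥0∞) + 1) ^ p * e n) := by
    intro n
    have hL : (1 : ℝ≥0∞) ≤ ((n : ℝ≥0∞) + 1) ^ p := ENNReal.one_le_rpow (by simp) hp0
    have hLT : ((n : ℝ≥0∞) + 1) ^ p ≠ ⊤ := ENNReal.rpow_ne_top_of_nonneg hp0.le (by simp)
    have h2T : (2 : ℝ≥0∞) ^ p ≠ ⊤ := ENNReal.rpow_ne_top_of_nonneg hp0.le (by simp)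
    have e1 : ∀ x, B n x ^ p ≤ U'.indicator (fun x => 2 ^ p * 2 ^ p * (((n : ℝ≥0∞) + 1) ^ p *
        (v' n x ^ p + g n x ^ p))) x := by
      intro x
      by_cases hx : x ∈ U'
      · simp only [hBdef, indicator_of_mem hx]
        rw [← mul_add, ENNReal.mul_rpow_of_nonneg _ _ hp0.le, mul_assoc]
        gcongr
        refine (two_rpow_add p hp _ _).trans ?_
        gcongr
        rw [ENNReal.mul_rpow_of_nonneg _ _ hp0.le, mul_add, add_comm]
        gcongr
        · simp
        · exact le_mul_of_one_le_left zero_le hL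
      · simp only [hBdef, indicator_of_notMem hx, ENNReal.zero_rpow_of_pos hp0, le_refl]
    calc _ ≤ _ := lintegral_mono e1
      _ = ∫⁻ x in U, 2 ^ p * 2 ^ p * (((n : ℝ≥0∞) + 1) ^ p * (v' n x ^ p + g n x ^ p)) ∂μ := by
          rw [lintegral_indicator hU'm, Measure.restrict_congr_set hae]
      _ = 2 ^ p * 2 ^ p * (((n : ℝ≥0∞) + 1) ^ p * ∫⁻ x in U, (v' n x ^ p + g n x ^ p) ∂μ) := by
          rw [lintegral_const_mul' _ _ (ENNReal.mul_ne_top h2T h2T), lintegral_const_mul' _ _ hLT]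
      _ ≤ _ := by
          gcongr
          rw [lintegral_add_left ((hv'm n).pow_const p)]
          refine le_trans (le_of_eq ?_) (hvN n).le
          congr 1
          refine lintegral_congr_ae ?_
          filter_upwards [hv'ae n] with x hx
          rw [hx]
  set S : ℝ≥0∞ := ∑' n : ℕ, ((n : ℝ≥0∞) + 1) ^ p * e n with hS
  have hBS : ∑' n, ∫⁻ x, B n x ^ p ∂μ ≤ 2 ^ p * 2 ^ p * S := by
    rw [hS, ← ENNReal.tsum_mul_left]
    exact ENNReal.tsum_le_tsum hBn
  have I1 : ∫⁻ x, ENNReal.ofReal (F x) ^ p ∂μ ≤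
      2 ^ p * (∫⁻ x, ENNReal.ofReal (w x) ^ p ∂μ + 2 ^ p * 2 ^ p * S) := by
    calc _ ≤ ∫⁻ x, (ENNReal.ofReal (w x) + ⨆ n, B n x) ^ p ∂μ := by
          refine lintegral_mono fun x => ?_
          gcongr
          exact hFB x
      _ ≤ _ := lint_bound μ p hp _ B hwm.ennreal_ofReal hBm
      _ ≤ _ := by gcongr
  have I2 : ∫⁻ x, Gr x ^ p ∂μ ≤ 2 ^ p * (2 ^ p * ∫⁻ x, gw x ^ p ∂μ + 2 ^ p * 2 ^ p * S) := by
    refine (lint_bound μ p hp _ B (hgwm.const_mul 2).aemeasurable hBm).trans ?_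
    gcongr
    refine le_of_eq ?_
    rw [← lintegral_const_mul _ (hgwm.pow_const p)]
    exact lintegral_congr fun x => ENNReal.mul_rpow_of_nonneg _ _ hp0.le
  refine (add_le_add I1 I2).trans ?_
  set q : ℝ≥0∞ := 2 ^ p with hq
  set a := ∫⁻ x, ENNReal.ofReal (w x) ^ p ∂μ
  set b := ∫⁻ x, gw x ^ p ∂μ
  have hqq : q ≤ 2 * q * q * q := by
    calc q = 1 * q * 1 * 1 := by ring
      _ ≤ _ := by gcongr; norm_num
  have hqq2 : q * q ≤ 2 * q * q * q := by
    calc q * q = 1 * q * q * 1 := by ring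
      _ ≤ _ := by gcongr; norm_num
  calc q * (a + q * q * S) + q * (q * b + q * q * S)
      = q * a + q * q * b + 2 * q * q * q * S := by ring
    _ ≤ 2 * q * q * q * a + 2 * q * q * q * b + 2 * q * q * q * S := by gcongr
    _ = 2 * q * q * q * ((a + b) + S) := by ring
    _ ≤ _ := by gcongr

/-- On a quasiopen set, `C_p^U`-quasicontinuity implies `C_p`-quasicontinuity. -/
theorem stmt12 (μ : Measure X) (p : ℝ) (hp : 1 ≤ p)
    (hball : ∀ (x : X) (r : ℝ), μ (Metric.ball x r) < ⊤)
    (U : Set X) (hU : Quasiopen μ p U) (u : X → EReal)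
    (hu : QuasicontOnSub μ p u U) :
    QuasicontOn μ p u U := by
  intro ε hε
  have hp0 : 0 < p := by linarith
  obtain ⟨U', hU'm, hUU', hae⟩ := quasiopen_borel μ p hp U hU
  obtain ⟨e, he0, hesum⟩ := ENNReal.exists_pos_sum_of_countable' hε.ne' ℕ
  set K : ℝ≥0∞ := 2 * 2 ^ p * 2 ^ p * 2 ^ p with hK
  have h2T : (2 : ℝ≥0∞) ^ p ≠ ⊤ := ENNReal.rpow_ne_top_of_nonneg hp0.le (by simp)
  have h20 : (2 : ℝ≥0∞) ^ p ≠ 0 := (ENNReal.rpow_pos (by simp) (by simp)).ne'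
  have hKT : K ≠ ⊤ :=
    ENNReal.mul_ne_top (ENNReal.mul_ne_top (ENNReal.mul_ne_top (by simp) h2T) h2T) h2T
  have hK0 : K ≠ 0 := mul_ne_zero (mul_ne_zero (mul_ne_zero (by simp) h20) h20) h20
  have hLT : ∀ n : ℕ, ((n : ℝ≥0∞) + 1) ^ p ≠ ⊤ := fun n =>
    ENNReal.rpow_ne_top_of_nonneg hp0.le (by simp)
  have hL0 : ∀ n : ℕ, ((n : ℝ≥0∞) + 1) ^ p ≠ 0 := fun n =>
    (ENNReal.rpow_pos (by simp) (by simp)).ne'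
  obtain ⟨G', hG'o, hG'c, hG'U⟩ := hU (e 0 / K) (ENNReal.div_pos (he0 0).ne' hKT)
  obtain ⟨η, W, hη, hη0, hηΩ, hWo, hW1, hWΩ, hWex⟩ := exists_cutoff (G' ∪ U) hG'U
  choose H hHU hHo hHc hHcont hHfin using fun n : ℕ =>
    hu (e (n + 1) / K / ((n : ℝ≥0∞) + 1) ^ p)
      (ENNReal.div_pos (ENNReal.div_pos (he0 _).ne' hKT).ne' (hLT n))
  choose V hVo hHV using hHo
  have hcap := cap_estimate μ p hp U U' (G' ∪ U) G' hU'm hUU' hae hG'U rfl η W hη hη0 hηΩ hW1 H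
    _ _ hG'c hHc
  have hset : G' ∪ ⋃ n, (H n ∩ W n) = G' ∪ ⋃ n, (V n ∩ W n) := by
    ext x
    simp only [mem_union, mem_iUnion, mem_inter_iff]
    constructor
    · rintro (h | ⟨n, h1, h3⟩)
      · exact Or.inl h
      · rw [hHV n] at h1
        exact Or.inr ⟨n, h1.1, h3⟩
    · rintro (h | ⟨n, h1, h3⟩)
      · exact Or.inl h
      · rcases hWΩ n h3 with h4 | h4
        · exact Or.inl h4
        · refine Or.inr ⟨n, ?_, h3⟩
          rw [hHV n]; exact ⟨h1, h4⟩
  have hloc : ∀ x ∈ U \ (G' ∪ ⋃ n, (H n ∩ W n)), ∃ n, x ∈ W n ∧ x ∈ U \ H n := by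
    rintro x ⟨hxU, hxG⟩
    obtain ⟨n, hn⟩ := hWex x (Or.inr hxU)
    exact ⟨n, hn, hxU, fun h => hxG (Or.inr (mem_iUnion.2 ⟨n, h, hn⟩))⟩
  refine ⟨G' ∪ ⋃ n, (H n ∩ W n), ?_, ?_, ?_, ?_⟩
  · rw [hset]
    exact hG'o.union (isOpen_iUnion fun n => (hVo n).inter (hWo n))
  · refine lt_of_le_of_lt (hcap.trans (le_of_eq ?_)) hesum
    have hsplit : ∑' n, e n = e 0 + ∑' n, e (n + 1) :=
      tsum_eq_zero_add' (M := ℝ≥0∞) ENNReal.summable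
    rw [hsplit, mul_add, ENNReal.mul_div_cancel hK0 hKT, ← ENNReal.tsum_mul_left]
    congr 1
    refine tsum_congr fun n => ?_
    rw [ENNReal.mul_div_cancel (hL0 n) (hLT n), ENNReal.mul_div_cancel hK0 hKT]
  · intro x hx
    obtain ⟨n, hn, hxn⟩ := hloc x hx
    have h1 := hHcont n x hxn
    refine h1.mono_of_mem_nhdsWithin ?_
    filter_upwards [self_mem_nhdsWithin, nhdsWithin_le_nhds ((hWo n).mem_nhds hn)] with y hy hyW
    exact ⟨hy.1, fun h => hy.2 (Or.inr (mem_iUnion.2 ⟨n, h, hyW⟩))⟩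
  · intro x hx
    obtain ⟨n, -, hxn⟩ := hloc x hx
    exact hHfin n x hxn


end
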